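/- The only integer solutions (s, t) to the Thue equation s^4 - 8·s^3·t + 6·s^2·t^2 - 8·s·t^3 + t^4 = 1 are (s,t) ∈ {(1,0), (-1,0), (0,1), (0,-1)}. -/

import Mathlib

open QuadraticAlgebra

/-- The ring `ℤ[√3]`. -/
abbrev ZSqrtThree : Type := QuadraticAlgebra ℤ 3 0

/-- The ring `ℤ[ζ]` with `ζ ^ 4 = 3`, as the quadratic extension of `ℤ[√3]` by `ζ = √√3`. The
coordinates of `a + b ζ + c ζ ^ 2 + d ζ ^ 3` are grouped as `⟨⟨a, c⟩, ⟨b, d⟩⟩`. -/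
abbrev ZFourthRootThree : Type := QuadraticAlgebra ZSqrtThree ⟨0, 1⟩ 0

namespace ZFourthRootThree

/-- The unit `2 + √3` of `ℤ[√3]`. -/
def baseUnit : ZSqrtThreeˣ := ⟨⟨2, 1⟩, ⟨2, -1⟩, by decide, by decide⟩

/-- The unit `2 + √3` of `ℤ[ζ]`. -/
def ε : ZFourthRootThreeˣ :=
  ⟨⟨⟨2, 1⟩, 0⟩, ⟨⟨2, -1⟩, 0⟩, by decide, by decide⟩

/-- The unit `2 + ζ + ζ ^ 2 + ζ ^ 3`, of relative norm `1` over `ℤ[√3]`. -/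
def η : ZFourthRootThreeˣ :=
  ⟨⟨⟨2, 1⟩, ⟨1, 1⟩⟩, ⟨⟨2, 1⟩, ⟨-1, -1⟩⟩, by decide, by decide⟩

/-- The sum of the coefficients of `ζ` and `ζ ^ 2`. -/
def coeffSumOneTwo : ZFourthRootThree →+ ℤ where
  toFun z := z.im.re + z.re.im
  map_zero' := by simp
  map_add' x y := by simp; ring

/-- The sum of the coefficients of `ζ ^ 2` and `ζ ^ 3`. -/
def coeffSumTwoThree : ZFourthRootThree →+ ℤ where
  toFun z := z.re.im + z.im.im
  map_zero' := by simp
  map_add' x y := by simp; ring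

theorem exponents_of_dvd_coeffSums : ∀ m ∈ Finset.range 5, ∀ j ∈ Finset.range 30,
    19 ∣ coeffSumOneTwo ((ε : ZFourthRootThree) ^ m * (η : ZFourthRootThree) ^ j) →
    19 ∣ coeffSumTwoThree ((ε : ZFourthRootThree) ^ m * (η : ZFourthRootThree) ^ j) →
    m = 0 ∧ (j = 0 ∨ j = 29) := by
  decide +kernel

theorem ε_pow_five : (361 : ZFourthRootThree) ∣ ((ε ^ 5 : ZFourthRootThreeˣ) : ZFourthRootThree)
    - 1 - 19 * ⟨⟨0, 11⟩, 0⟩ :=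
  ⟨⟨1, 0⟩, by decide +kernel⟩

theorem neg_η_pow_thirty :
    (361 : ZFourthRootThree) ∣ ((-η ^ 30 : ZFourthRootThreeˣ) : ZFourthRootThree)
      - 1 - 19 * ⟨0, ⟨11, 4⟩⟩ :=
  ⟨⟨⟨-61566165554105383076702, -35545242255635808184776⟩,
    ⟨-46780169616743122955087, -27008543520962994369462⟩⟩, by decide +kernel⟩

theorem sq_sub_one_dvd_zpow {R : Type*} [CommRing R] (u : Rˣ) (k : ℤ) :
    ((u : R) - 1) ^ 2 ∣ ((u ^ k : Rˣ) : R) - 1 - k * (u - 1) := by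
  induction k using Int.induction_on with
  | zero => simp
  | succ i ih =>
    obtain ⟨q, hq⟩ := ih
    refine ⟨u * q + i, ?_⟩
    rw [zpow_add_one, Units.val_mul]
    push_cast at hq ⊢
    linear_combination (u : R) * hq
  | pred i ih =>
    obtain ⟨q, hq⟩ := ih
    refine ⟨(u⁻¹ : Rˣ) * q + (i + 1) * (u⁻¹ : Rˣ), ?_⟩
    rw [zpow_sub_one, Units.val_mul]
    push_cast at hq ⊢
    have hu : (u : R) * (u⁻¹ : Rˣ) = 1 := Units.mul_inv u
    linear_combination ((u⁻¹ : Rˣ) : R) * hq + (i + 2 - (i + 1) * u) * hu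

/-- A first-order expansion of `19`-power multiples of exponents: if `u ≡ 1 + 19 α` modulo `19 ^ 2`,
then `u ^ (19 ^ r * k) ≡ 1 + 19 ^ (r + 1) * k * α` modulo `19 ^ (r + 2)`. -/
theorem zpow_nineteen_pow_mul {R : Type*} [CommRing R] {u : Rˣ} {α : R}
    (h : 361 ∣ (u : R) - 1 - 19 * α) (r : ℕ) (k : ℤ) :
    (19 : R) ^ (r + 2) ∣ ((u ^ (19 ^ r * k) : Rˣ) : R) - 1 - 19 ^ (r + 1) * (k * α) := by
  induction r with
  | zero =>
    obtain ⟨x, hx⟩ := h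
    obtain ⟨q, hq⟩ := sq_sub_one_dvd_zpow u k
    refine ⟨k * x + (α + 19 * x) ^ 2 * q, ?_⟩
    have hu : (u : R) = 1 + 19 * α + 361 * x := by linear_combination hx
    simp only [pow_zero, one_mul]
    rw [hu] at hq
    linear_combination hq
  | succ r ih =>
    obtain ⟨x, hx⟩ := ih
    have hv : ((u ^ (19 ^ r * k) : Rˣ) : R) = 1 + 19 * (19 ^ r * (k * α + 19 * x)) := by
      linear_combination hx
    have he : (19 ^ (r + 1) * k : ℤ) = (19 ^ r * k) * (19 : ℕ) := by push_cast; ring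
    rw [he, zpow_mul, zpow_natCast, Units.val_pow_eq_pow_val, hv]
    generalize hS : (19 : R) ^ r = S
    have expand : ∀ z : R, ∃ q, (1 + z) ^ 19 = 1 + 19 * z + 171 * z ^ 2 + z ^ 3 * q := fun z ↦
      ⟨969 + 3876 * z + 11628 * z ^ 2 + 27132 * z ^ 3 + 50388 * z ^ 4 + 75582 * z ^ 5 +
        92378 * z ^ 6 + 92378 * z ^ 7 + 75582 * z ^ 8 + 50388 * z ^ 9 + 27132 * z ^ 10 +
        11628 * z ^ 11 + 3876 * z ^ 12 + 969 * z ^ 13 + 171 * z ^ 14 + 19 * z ^ 15 + z ^ 16,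
        by ring⟩
    obtain ⟨q, hq⟩ := expand (19 * (S * (k * α + 19 * x)))
    rw [hq]
    refine ⟨x + 9 * S * (k * α + 19 * x) ^ 2 + S ^ 2 * (k * α + 19 * x) ^ 3 * q, ?_⟩
    simp only [pow_add, hS]
    ring

theorem dvd_linear_combination_of_map_mul_eq_zero (L : ZFourthRootThree →+ ℤ) (hL : L 1 = 0) {r : ℕ} {a b : ℤ}
    {x y α β : ZFourthRootThree} (h : L (x * y) = 0)
    (hx : (19 : ZFourthRootThree) ^ (r + 2) ∣ x - 1 - 19 ^ (r + 1) * (a * α))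
    (hy : (19 : ZFourthRootThree) ^ (r + 2) ∣ y - 1 - 19 ^ (r + 1) * (b * β)) :
    19 ∣ a * L α + b * L β := by
  obtain ⟨x', hx⟩ := hx
  obtain ⟨y', hy⟩ := hy
  rw [sub_sub, sub_eq_iff_eq_add] at hx hy
  have : x * y = 1 + (19 ^ (r + 1) : ℤ) • (a • α + b • β + (19 : ℤ) •
      (x' * y + y' + 19 ^ r * (a * α) * (b * β + 19 * y'))) := by
    rw [hx, hy]
    simp only [zsmul_eq_mul]
    push_cast
    ring
  rw [this, map_add, hL, map_zsmul, map_add, map_add, map_zsmul, map_zsmul, map_zsmul] at h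
  simp only [smul_eq_mul, zero_add, mul_eq_zero, pow_eq_zero_iff', OfNat.ofNat_ne_zero,
    false_and, false_or] at h
  omega

theorem eq_zero_of_forall_pow_dvd {m : ℤ} (h : ∀ r : ℕ, 19 ^ r ∣ m) : m = 0 := by
  by_contra hm
  have h' := Int.natAbs_dvd_natAbs.2 (h m.natAbs)
  rw [Int.natAbs_pow] at h'
  exact absurd (Nat.le_of_dvd (Int.natAbs_pos.2 hm) h') (not_le.2 (Nat.lt_pow_self (by decide)))

theorem exponents_eq_zero_of_functionals {L₁ L₂ : ZFourthRootThree →+ ℤ} (hL₁ : L₁ 1 = 0)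
    (hL₂ : L₂ 1 = 0)
    (hdet : ∀ a b : ℤ, 19 ∣ a * L₁ ⟨⟨0, 11⟩, 0⟩ + b * L₁ ⟨0, ⟨11, 4⟩⟩ →
      19 ∣ a * L₂ ⟨⟨0, 11⟩, 0⟩ + b * L₂ ⟨0, ⟨11, 4⟩⟩ → 19 ∣ a ∧ 19 ∣ b) {m j : ℤ}
    (h₁ : L₁ (((ε ^ 5) ^ m : ZFourthRootThreeˣ) * ((-η ^ 30) ^ j : ZFourthRootThreeˣ)) = 0)
    (h₂ : L₂ (((ε ^ 5) ^ m : ZFourthRootThreeˣ) * ((-η ^ 30) ^ j : ZFourthRootThreeˣ)) = 0) :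
    m = 0 ∧ j = 0 := by
  have key (r : ℕ) : 19 ^ r ∣ m ∧ 19 ^ r ∣ j := by
    induction r with
    | zero => simp
    | succ r ih =>
      obtain ⟨⟨a, rfl⟩, ⟨b, rfl⟩⟩ := ih
      have hx := zpow_nineteen_pow_mul ε_pow_five r a
      have hy := zpow_nineteen_pow_mul neg_η_pow_thirty r b
      obtain ⟨ha, hb⟩ := hdet a b
        (dvd_linear_combination_of_map_mul_eq_zero L₁ hL₁ h₁ hx hy)
        (dvd_linear_combination_of_map_mul_eq_zero L₂ hL₂ h₂ hx hy)
      rw [pow_succ]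
      exact ⟨mul_dvd_mul_left _ ha, mul_dvd_mul_left _ hb⟩
  exact ⟨eq_zero_of_forall_pow_dvd fun r ↦ (key r).1,
    eq_zero_of_forall_pow_dvd fun r ↦ (key r).2⟩

theorem exponents_of_coeffSums_eq_zero {m j : ℤ}
    (h₁ : coeffSumOneTwo (ε ^ m * η ^ j : ZFourthRootThreeˣ) = 0)
    (h₂ : coeffSumTwoThree (ε ^ m * η ^ j : ZFourthRootThreeˣ) = 0) :
    m = 0 ∧ (j = 0 ∨ j = -1) := by
  obtain ⟨m₁, m₀, hm₀, rfl⟩ : ∃ (m₁ : ℤ) (m₀ : ℕ), m₀ < 5 ∧ m = 5 * m₁ + m₀ :=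
    ⟨m / 5, (m % 5).toNat, by omega, by omega⟩
  obtain ⟨j₁, j₀, hj₀, rfl⟩ : ∃ (j₁ : ℤ) (j₀ : ℕ), j₀ < 30 ∧ j = 30 * j₁ + j₀ :=
    ⟨j / 30, (j % 30).toNat, by omega, by omega⟩
  have hη (k : ℤ) : η ^ (30 * k) = (-η ^ 30) ^ k ∨ η ^ (30 * k) = -(-η ^ 30) ^ k := by
    rw [zpow_mul, zpow_ofNat]
    rcases Int.even_or_odd k with hk | hk
    · exact .inl (hk.neg_zpow _).symm
    · exact .inr (by rw [hk.neg_zpow, neg_neg])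
  have hε (k : ℤ) : ε ^ (5 * k) = (ε ^ 5) ^ k := by rw [zpow_mul, zpow_ofNat]
  have of_neg (L : ZFourthRootThree →+ ℤ) (g : ZFourthRootThreeˣ) (k : ℤ)
      (h : L (g * η ^ (30 * k) : ZFourthRootThreeˣ) = 0) :
      L (g * (-η ^ 30) ^ k : ZFourthRootThreeˣ) = 0 := by
    rcases hη k with hk | hk <;> rw [hk] at h
    · exact h
    · rwa [mul_neg, Units.val_neg, map_neg, neg_eq_zero] at h
  have hdvd (L : ZFourthRootThree →+ ℤ)
      (h : L (ε ^ (5 * m₁ + m₀) * η ^ (30 * j₁ + j₀) : ZFourthRootThreeˣ) = 0) :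
      19 ∣ L ((ε : ZFourthRootThree) ^ m₀ * (η : ZFourthRootThree) ^ j₀) := by
    obtain ⟨x, hx⟩ := zpow_nineteen_pow_mul ε_pow_five 0 m₁
    obtain ⟨y, hy⟩ := zpow_nineteen_pow_mul neg_η_pow_thirty 0 j₁
    rw [sub_sub, sub_eq_iff_eq_add] at hx hy
    have e : ε ^ (5 * m₁ + m₀) * η ^ (30 * j₁ + j₀) =
        ε ^ m₀ * η ^ j₀ * (ε ^ 5) ^ m₁ * η ^ (30 * j₁) := by
      rw [zpow_add, zpow_add, zpow_natCast, zpow_natCast, hε]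
      ac_rfl
    rw [e] at h
    have h' := of_neg L _ j₁ h
    simp only [pow_zero, one_mul, zero_add, pow_one] at hx hy
    obtain ⟨z, hz⟩ : ∃ z, ((ε ^ m₀ * η ^ j₀ * (ε ^ 5) ^ m₁ * (-η ^ 30) ^ j₁ :
        ZFourthRootThreeˣ) : ZFourthRootThree) =
        (ε : ZFourthRootThree) ^ m₀ * (η : ZFourthRootThree) ^ j₀ + (19 : ℤ) • z := by
      rw [Units.val_mul, Units.val_mul, hx, hy, Units.val_mul, Units.val_pow_eq_pow_val,
        Units.val_pow_eq_pow_val]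
      generalize (ε : ZFourthRootThree) ^ m₀ * (η : ZFourthRootThree) ^ j₀ = w
      generalize (m₁ : ZFourthRootThree) * _ = X
      generalize (j₁ : ZFourthRootThree) * _ = Y
      refine ⟨w * ((19 * x + X) + (19 * y + Y) + 19 * (19 * x + X) * (19 * y + Y)), ?_⟩
      rw [zsmul_eq_mul]
      push_cast
      ring
    rw [hz, map_add, map_zsmul, smul_eq_mul] at h'
    omega
  obtain ⟨rfl, rfl | rfl⟩ := exponents_of_dvd_coeffSums m₀ (Finset.mem_range.2 hm₀) j₀
    (Finset.mem_range.2 hj₀) (hdvd _ h₁) (hdvd _ h₂)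
  · simp only [Nat.cast_zero, add_zero, hε] at h₁ h₂ ⊢
    obtain ⟨rfl, rfl⟩ := exponents_eq_zero_of_functionals (by decide) (by decide)
      (by simp [coeffSumOneTwo, coeffSumTwoThree]; omega) (of_neg _ _ _ h₁) (of_neg _ _ _ h₂)
    simp
  · have e : ε ^ (5 * m₁ + (0 : ℕ)) * η ^ (30 * j₁ + (29 : ℕ)) =
        η⁻¹ * (ε ^ 5) ^ m₁ * η ^ (30 * (j₁ + 1)) := by
      rw [Nat.cast_zero, add_zero, hε, mul_comm η⁻¹, mul_assoc, ← zpow_neg_one, ← zpow_add]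
      congr 2
      push_cast
      ring
    rw [e] at h₁ h₂
    have h₁ := of_neg _ _ _ h₁
    have h₂ := of_neg _ _ _ h₂
    rw [mul_assoc, Units.val_mul] at h₁ h₂
    obtain ⟨rfl, hj⟩ := exponents_eq_zero_of_functionals
      (L₁ := coeffSumOneTwo.comp (AddMonoidHom.mulLeft (η⁻¹ : ZFourthRootThreeˣ)))
      (L₂ := coeffSumTwoThree.comp (AddMonoidHom.mulLeft (η⁻¹ : ZFourthRootThreeˣ)))
      (by decide) (by decide)
      (by simp [coeffSumOneTwo, coeffSumTwoThree, η]; omega) h₁ h₂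
    exact ⟨by simp, .inr (by push_cast; omega)⟩

/-- The real embedding of `ℤ[ζ]` with `ζ = √√3`. -/
noncomputable def toReal : ZFourthRootThree →+* ℝ where
  toFun z := z.re.re + z.im.re * √√3 + z.re.im * √√3 ^ 2 + z.im.im * √√3 ^ 3
  map_zero' := by simp
  map_one' := by simp
  map_add' x y := by simp; ring
  map_mul' x y := by
    have h : √√3 ^ 4 = (3 : ℝ) := by
      rw [show 4 = 2 * 2 from rfl, pow_mul, Real.sq_sqrt (by positivity),
        Real.sq_sqrt (by positivity)]
    simp only [re_mul, im_mul, re_add, im_add, re_zero, im_zero]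
    push_cast
    linear_combination (-(x.im.re * y.im.im + x.re.im * y.re.im + x.im.im * y.im.re : ℝ)
      - (x.re.im * y.im.im + x.im.im * y.re.im : ℝ) * √√3
      - (x.im.im * y.im.im : ℝ) * √√3 ^ 2) * h

theorem toReal_η : 1 < toReal η := by
  have : 0 < √√(3 : ℝ) := by positivity
  simp only [toReal, η, RingHom.coe_mk, MonoidHom.coe_mk, OneHom.coe_mk]
  push_cast
  nlinarith [pow_pos this 2, pow_pos this 3]

theorem add_lt_add_of_mul_eq_one {x x' y y' : ℝ} (hx : x * x' = 1) (hy : y * y' = 1)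
    (h₁ : 1 ≤ x) (h₂ : x < y) : x + x' < y + y' := by
  have hx' : 0 < x' := by by_contra! h; nlinarith
  have hy' : 0 < y' := by by_contra! h; nlinarith
  have : y' < 1 := by nlinarith
  have : x' ≤ 1 := by nlinarith
  have : 0 < (y - x) * (1 - x' * y') := mul_pos (by linarith) (by nlinarith)
  linear_combination this + y' * hx - x' * hy

theorem two_le_add_of_mul_eq_one {x x' : ℝ} (h : x * x' = 1) (hx : 0 < x) : 2 ≤ x + x' := by
  have hx' : 0 < x' := by by_contra! h; nlinarith
  nlinarith [sq_nonneg (x - x')]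

theorem eq_one_of_toReal_mem {z : ZFourthRootThree} (hz : z.norm = 1) (h₁ : 1 ≤ toReal z)
    (h₂ : toReal z < toReal η) : z = 1 := by
  obtain ⟨⟨a, c⟩, ⟨b, d⟩⟩ := z
  rw [norm_def] at hz
  have e₁ : a ^ 2 + 3 * c ^ 2 - 6 * b * d = 1 := by
    have := congrArg QuadraticAlgebra.re hz
    simp at this
    linear_combination this
  have e₂ : 2 * a * c = b ^ 2 + 3 * d ^ 2 := by
    have := congrArg QuadraticAlgebra.im hz
    simp at this
    linear_combination this
  have r₁ : (a ^ 2 + 3 * c ^ 2 - 6 * b * d : ℝ) = 1 := mod_cast e₁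
  have r₂ : (2 * a * c : ℝ) = b ^ 2 + 3 * d ^ 2 := mod_cast e₂
  simp only [toReal, η, RingHom.coe_mk, MonoidHom.coe_mk, OneHom.coe_mk] at h₁ h₂
  have hζ : √√3 ^ 2 = √(3 : ℝ) := Real.sq_sqrt (by positivity)
  have hρ : √3 ^ 2 = (3 : ℝ) := Real.sq_sqrt (by positivity)
  have hρ₀ : 0 < √(3 : ℝ) := by positivity
  generalize √√(3 : ℝ) = ζ at *
  generalize √(3 : ℝ) = ρ at *
  have hρ₁ : 1.7 < ρ := by nlinarith
  have hρ₂ : ρ < 1.8 := by nlinarith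
  push_cast at h₁ h₂
  have h4 : ζ ^ 4 = 3 := by linear_combination (ζ ^ 2 + ρ) * hζ + hρ
  have hinv : (a + b * ζ + c * ζ ^ 2 + d * ζ ^ 3) * (a - b * ζ + c * ζ ^ 2 - d * ζ ^ 3) = 1 := by
    linear_combination r₁ + ζ ^ 2 * r₂ + (c ^ 2 - 2 * b * d - d ^ 2 * ζ ^ 2) * h4
  have hx := add_lt_add_of_mul_eq_one (x' := a - b * ζ + c * ζ ^ 2 - d * ζ ^ 3)
    (y' := 2 - 1 * ζ + 1 * ζ ^ 2 - 1 * ζ ^ 3) hinv (by linear_combination (-(1 + ζ ^ 2)) * h4)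
    h₁ h₂
  have hx₂ : a + c * ρ < 2 + ρ := by rw [← hζ]; linarith
  have hx₁ : 1 ≤ a + c * ρ := by
    have := two_le_add_of_mul_eq_one hinv (by linarith)
    rw [← hζ]
    linarith
  have hconj : (a - c * ρ) ^ 2 + ρ * (b - d * ρ) ^ 2 = 1 := by
    linear_combination r₁ - ρ * r₂ + (c ^ 2 - 2 * b * d + d ^ 2 * ρ) * hρ
  have hconj' : (a - c * ρ) ^ 2 ≤ 1 := by nlinarith [mul_nonneg hρ₀.le (sq_nonneg (b - d * ρ))]
  obtain ⟨hl, hu⟩ := abs_le.1 ((sq_le_one_iff_abs_le_one _).1 hconj')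
  have hc₀ : 0 ≤ c := by
    have : (-1 : ℝ) < c := by nlinarith
    have : -1 < c := mod_cast this
    omega
  have hc₁ : c < 2 := by
    have : (c : ℝ) < 2 := by nlinarith
    exact_mod_cast this
  interval_cases c
  · have hd : d = 0 := by nlinarith
    have hb : b = 0 := by nlinarith
    rw [Int.cast_zero, zero_mul, add_zero] at hx₁
    have ha : 1 ≤ a := by exact_mod_cast (by linarith : (1 : ℝ) ≤ a)
    have : a = 1 := by nlinarith
    subst hd hb this
    rfl
  · rw [Int.cast_one, one_mul] at hx₂ hl
    have ha₁ : 0 < a := by exact_mod_cast (by linarith : (0 : ℝ) < a)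
    have ha₂ : a < 2 := by exact_mod_cast (by linarith : (a : ℝ) < 2)
    have : a = 1 := by omega
    subst this
    rw [mul_assoc] at e₁
    omega

theorem exists_eq_zpow_of_norm_eq_one (u : ZFourthRootThreeˣ)
    (hu : (u : ZFourthRootThree).norm = 1) : ∃ j : ℤ, u = η ^ j ∨ u = -η ^ j := by
  wlog hpos : 0 < toReal u generalizing u
  · have hne : toReal u ≠ 0 := (u.isUnit.map toReal).ne_zero
    obtain ⟨j, hj⟩ := this (-u) (by rw [Units.val_neg, QuadraticAlgebra.norm_neg, hu]) (by
      rw [Units.val_neg, map_neg]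
      exact neg_pos.2 (lt_of_le_of_ne (not_lt.1 hpos) hne))
    exact ⟨j, hj.symm.imp neg_inj.1 neg_eq_iff_eq_neg.1⟩
  have hη : 0 < toReal η := zero_lt_one.trans toReal_η
  have hmap (v : ZFourthRootThreeˣ) (k : ℤ) :
      toReal (v ^ k : ZFourthRootThreeˣ) = toReal v ^ k := by
    have := congrArg Units.val (map_zpow (Units.map (toReal : ZFourthRootThree →* ℝ)) v k)
    rwa [Units.val_zpow_eq_zpow_val] at this
  obtain ⟨j, hj₁, hj₂⟩ := exists_mem_Ico_zpow hpos toReal_η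
  refine ⟨j, .inl (mul_inv_eq_one.1 (Units.ext ?_))⟩
  have hval : toReal ((u * (η ^ j)⁻¹ : ZFourthRootThreeˣ) : ZFourthRootThree) =
      toReal u / toReal η ^ j := by
    rw [← zpow_neg, Units.val_mul, map_mul, hmap, zpow_neg, div_eq_mul_inv]
  have hpow : 0 < toReal η ^ j := zpow_pos hη j
  refine eq_one_of_toReal_mem ?_ ?_ ?_
  · have h : Units.map (norm : ZFourthRootThree →* ZSqrtThree) (u * (η ^ j)⁻¹) = 1 := by
      have h₁ : Units.map (norm : ZFourthRootThree →* ZSqrtThree) u = 1 := Units.ext hu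
      have h₂ : Units.map (norm : ZFourthRootThree →* ZSqrtThree) η = 1 := by decide
      rw [map_mul, map_inv, map_zpow, h₁, h₂]
      simp
    exact congrArg Units.val h
  · rw [hval]
    exact (one_le_div hpow).2 hj₁
  · rw [hval, div_lt_iff₀ hpow, mul_comm, ← zpow_add_one₀ hη.ne']
    exact hj₂

theorem isFundamental_seven_two :
    Pell.IsFundamental (Pell.Solution₁.mk 7 2 (by norm_num) : Pell.Solution₁ 12) := by
  refine ⟨by simp, by simp, fun {b} hb ↦ ?_⟩
  have key (x y : ℤ) (h₁ : 1 < x) (h₂ : x < 7) : x ^ 2 - 12 * y ^ 2 ≠ 1 := by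
    intro h
    have hy₁ : -2 < y := by nlinarith
    have hy₂ : y < 2 := by nlinarith
    interval_cases x <;> interval_cases y <;> omega
  exact not_lt.1 fun h ↦ key b.x b.y hb h b.prop

theorem eq_zpow_baseUnit {x y : ℤ} (h : x ^ 2 - 12 * y ^ 2 = 1) (hx : 0 < x) :
    ∃ n : ℤ, (⟨x, 2 * y⟩ : ZSqrtThree) = (baseUnit ^ (2 * n) : ZSqrtThreeˣ) := by
  let ψ : ℤ√12 →+* ZSqrtThree := Zsqrtd.lift ⟨⟨0, 2⟩, by decide⟩
  let f : Pell.Solution₁ 12 →* ZSqrtThreeˣ :=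
    (Units.map (ψ : ℤ√12 →* ZSqrtThree)).comp Unitary.toUnits
  have hf (x y : ℤ) (h : x ^ 2 - 12 * y ^ 2 = 1) :
      (f (Pell.Solution₁.mk x y h) : ZSqrtThree) = ⟨x, 2 * y⟩ := by
    have : (f (Pell.Solution₁.mk x y h) : ZSqrtThree) = ψ ⟨x, y⟩ := rfl
    rw [this]
    ext <;> simp [ψ, Zsqrtd.lift, mul_comm]
  obtain ⟨n, hn | hn⟩ := isFundamental_seven_two.eq_zpow_or_neg_zpow (.mk x y h)
  · refine ⟨n, ?_⟩
    rw [← hf x y h, hn, map_zpow, zpow_mul]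
    congr 2
  · have := congrArg Pell.Solution₁.x hn
    rw [Pell.Solution₁.x_mk, Pell.Solution₁.x_neg] at this
    have := Pell.Solution₁.x_zpow_pos isFundamental_seven_two.x_pos n
    omega

theorem exists_exponents_of_thue_eq_one {s t : ℤ}
    (h : s ^ 4 - 8 * s ^ 3 * t + 6 * s ^ 2 * t ^ 2 - 8 * s * t ^ 3 + t ^ 4 = 1) :
    ∃ m j : ℤ,
      (⟨⟨s - 2 * t, -t⟩, ⟨t, t⟩⟩ : ZFourthRootThree) = (ε ^ m * η ^ j : ZFourthRootThreeˣ) ∨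
      (⟨⟨s - 2 * t, -t⟩, ⟨t, t⟩⟩ : ZFourthRootThree) = (-(ε ^ m * η ^ j) : ZFourthRootThreeˣ) := by
  have hx : 0 < s ^ 2 - 4 * s * t + t ^ 2 := by
    by_contra! hx
    nlinarith [sq_nonneg (s - t), sq_nonneg (s + t)]
  obtain ⟨n, hn⟩ := eq_zpow_baseUnit (x := s ^ 2 - 4 * s * t + t ^ 2) (y := -(s * t))
    (by linear_combination h) hx
  have hnorm : (⟨⟨s - 2 * t, -t⟩, ⟨t, t⟩⟩ : ZFourthRootThree).norm =
      (baseUnit ^ (2 * n) : ZSqrtThreeˣ) := by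
    rw [← hn, norm_def]
    ext <;> simp <;> ring
  obtain ⟨w, hw⟩ := isUnit_iff_norm_isUnit.2 (hnorm ▸ Units.isUnit _)
  rw [← hw] at hnorm ⊢
  have hε : Units.map (norm : ZFourthRootThree →* ZSqrtThree) ε = baseUnit ^ 2 := by decide
  have hu : Units.map (norm : ZFourthRootThree →* ZSqrtThree) (w * (ε ^ n)⁻¹) = 1 := by
    have : Units.map (norm : ZFourthRootThree →* ZSqrtThree) w = baseUnit ^ (2 * n) :=
      Units.ext hnorm
    rw [map_mul, map_inv, map_zpow, this, hε, zpow_mul, zpow_ofNat, mul_inv_cancel]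
  obtain ⟨j, hj⟩ := exists_eq_zpow_of_norm_eq_one _ (congrArg Units.val hu)
  refine ⟨n, j, hj.imp (fun hj ↦ ?_) (fun hj ↦ ?_)⟩
  · rw [← hj, mul_comm, inv_mul_cancel_right]
  · rw [← mul_neg, ← hj, mul_comm, inv_mul_cancel_right]

end ZFourthRootThree

/-- The only integer solutions to `s^4 - 8s^3t + 6s^2t^2 - 8st^3 + t^4 = 1` are
`(±1, 0)` and `(0, ±1)`. -/
theorem stmt_10 (s t : ℤ) :
    s ^ 4 - 8 * s ^ 3 * t + 6 * s ^ 2 * t ^ 2 - 8 * s * t ^ 3 + t ^ 4 = 1 ↔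
      (s = 1 ∧ t = 0) ∨ (s = -1 ∧ t = 0) ∨ (s = 0 ∧ t = 1) ∨ (s = 0 ∧ t = -1) := by
  refine ⟨fun h ↦ ?_, ?_⟩
  · obtain ⟨m, j, hmj⟩ := ZFourthRootThree.exists_exponents_of_thue_eq_one h
    have key (L : ZFourthRootThree →+ ℤ) (hL : L ⟨⟨s - 2 * t, -t⟩, ⟨t, t⟩⟩ = 0) :
        L (ZFourthRootThree.ε ^ m * ZFourthRootThree.η ^ j : ZFourthRootThreeˣ) = 0 := by
      rcases hmj with hmj | hmj <;> rw [hmj] at hL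
      · exact hL
      · rwa [Units.val_neg, map_neg, neg_eq_zero] at hL
    obtain ⟨rfl, rfl | rfl⟩ := ZFourthRootThree.exponents_of_coeffSums_eq_zero
      (key _ (by simp [ZFourthRootThree.coeffSumOneTwo]))
      (key _ (by simp [ZFourthRootThree.coeffSumTwoThree]))
    all_goals
      simp [ZFourthRootThree.η, QuadraticAlgebra.ext_iff] at hmj
      omega
  · rintro (⟨rfl, rfl⟩ | ⟨rfl, rfl⟩ | ⟨rfl, rfl⟩ | ⟨rfl, rfl⟩) <;> norm_num
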